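/- arXiv:2512.24105 — 2 statements merged into one kernel-verified Lean document; each statement's English description precedes it below -/
import Mathlib

section
/- The estimated utility v̂ is submodular: for all subsets S ⊆ T ⊆ G and every item g ∈ G \ T, one has v̂(S ∪ {g}) + v̂(T) ≥ v̂(T ∪ {g}) + v̂(S). -/
open scoped Classical

/-- A set function `u` on subsets of the finite ground set `I` (the set of items `G`)
is a *matroid rank function* (MRF): it vanishes on `∅`, is monotone, is submodular,
and has binary marginal gains. -/
def IsMRF {I : Type*} [DecidableEq I] (u : Finset I → ℕ) : Prop :=
  u ∅ = 0 ∧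
  (∀ S T : Finset I, S ⊆ T → u S ≤ u T) ∧
  (∀ S T : Finset I, S ⊆ T → ∀ g ∉ T, u (T ∪ {g}) + u S ≤ u (S ∪ {g}) + u T) ∧
  ∀ (S : Finset I) (g : I), g ∉ S → u S ≤ u (S ∪ {g}) ∧ u (S ∪ {g}) ≤ u S + 1

/-- A *local allocation* of the bundle `S` to the agents in `L`: a family of pairwise
disjoint subsets of `S`. -/
def IsLocalAlloc {I L : Type*} [DecidableEq I] (S : Finset I) (A : L → Finset I) : Prop :=
  (∀ x, A x ⊆ S) ∧ ∀ x y : L, x ≠ y → Disjoint (A x) (A y)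

/-- The *estimated utility* `v̂(S)`: the maximum, over local allocations `A` of `S`
to the agents in `L`, of `∑ x, u x (A x)`. -/
noncomputable def vhat {I L : Type*} [Fintype I] [DecidableEq I] [Fintype L] [DecidableEq L]
    (u : L → Finset I → ℕ) (S : Finset I) : ℕ :=
  (Finset.univ.filter fun A : L → Finset I => IsLocalAlloc S A).sup
    fun A => ∑ x, u x (A x)

section MatroidRank

variable {I : Type*} [DecidableEq I] {u : Finset I → ℕ}

theorem IsMRF.mono (hu : IsMRF u) {S T : Finset I} (h : S ⊆ T) : u S ≤ u T :=
  hu.2.1 S T h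

theorem IsMRF.union_disjoint_add_le (hu : IsMRF u) {S T : Finset I} (hST : S ⊆ T)
    (D : Finset I) (hD : Disjoint T D) : u (T ∪ D) + u S ≤ u (S ∪ D) + u T := by
  induction D using Finset.induction_on with
  | empty => simp [add_comm]
  | insert g D hg ih =>
    have hgT : g ∉ T := by grind [Finset.disjoint_left]
    have hTD : Disjoint T D := by grind [Finset.disjoint_left]
    have h₁ := ih hTD
    have h₂ := hu.2.2.1 (S ∪ D) (T ∪ D) (by grind) g (by grind)
    have h₃ : T ∪ insert g D = T ∪ D ∪ {g} := by grind
    have h₄ : S ∪ insert g D = S ∪ D ∪ {g} := by grind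
    rw [h₃, h₄]
    omega

theorem IsMRF.union_add_inter_le (hu : IsMRF u) (A B : Finset I) :
    u (A ∪ B) + u (A ∩ B) ≤ u A + u B := by
  have h := hu.union_disjoint_add_le (S := A ∩ B) (T := A) (by grind) (B \ A)
    Finset.disjoint_sdiff
  have h₁ : A ∪ B \ A = A ∪ B := by grind
  have h₂ : A ∩ B ∪ B \ A = B := by grind
  rw [h₁, h₂] at h
  omega

theorem IsMRF.union_le_add_card (hu : IsMRF u) (S D : Finset I) :
    u (S ∪ D) ≤ u S + D.card := by
  induction D using Finset.induction_on with
  | empty => simp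
  | insert g D hg ih =>
    rw [Finset.card_insert_of_notMem hg]
    by_cases hgS : g ∈ S
    · have h : S ∪ insert g D = S ∪ D := by grind
      rw [h]
      omega
    · have h := (hu.2.2.2 (S ∪ D) g (by grind)).2
      have h₁ : S ∪ insert g D = S ∪ D ∪ {g} := by grind
      rw [h₁]
      omega

end MatroidRank

section SharedUtility

variable {I L : Type*} [DecidableEq I] [Fintype L] [DecidableEq L]

/-- The total utility of `X` when every item `i` is given simultaneously to all agents in `F i`. -/
def sharedUtility (u : L → Finset I → ℕ) (F : I → Finset L) (X : Finset I) : ℕ :=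
  ∑ x, u x (X.filter fun i => x ∈ F i)

theorem sharedUtility_update_of_notMem (u : L → Finset I → ℕ) (F : I → Finset L) {X : Finset I}
    {e : I} (he : e ∉ X) (s : Finset L) :
    sharedUtility u (Function.update F e s) X = sharedUtility u F X := by
  refine Finset.sum_congr rfl fun x _ => congrArg (u x) (Finset.filter_congr fun i hi => ?_)
  rw [Function.update_of_ne (ne_of_mem_of_not_mem hi he)]

theorem sharedUtility_union_add_inter_erase_le (u : L → Finset I → ℕ) (hu : ∀ x, IsMRF (u x))
    (F : I → Finset L) {e : I} {a b : L} (hab : a ≠ b) {X Y : Finset I} (hX : e ∈ X)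
    (hY : e ∈ Y) :
    sharedUtility u F (X ∪ Y) + sharedUtility u F ((X ∩ Y).erase e) ≤
      sharedUtility u (Function.update F e ((F e).erase a)) X +
        sharedUtility u (Function.update F e ((F e).erase b)) Y := by
  unfold sharedUtility
  rw [← Finset.sum_add_distrib, ← Finset.sum_add_distrib]
  refine Finset.sum_le_sum fun x _ => le_trans (Nat.add_le_add ((hu x).mono ?_) ((hu x).mono ?_))
    ((hu x).union_add_inter_le _ _)
  · intro i hi
    by_cases hie : i = e
    · subst hie
      by_cases hxa : x = a <;> simp_all
    · simp_all
  · intro i hi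
    simp_all

end SharedUtility

section Allocation

variable {I L : Type*} [Fintype I] [DecidableEq I] [Fintype L] [DecidableEq L]

theorem IsLocalAlloc.sum_le_vhat (u : L → Finset I → ℕ) {S : Finset I} {A : L → Finset I}
    (hA : IsLocalAlloc S A) : ∑ x, u x (A x) ≤ vhat u S :=
  Finset.le_sup (f := fun A : L → Finset I => ∑ x, u x (A x)) (by simpa using hA)

/-- The easy inequality of the matroid union theorem. -/
theorem vhat_le (u : L → Finset I → ℕ) (hu : ∀ x, IsMRF (u x)) (S X : Finset I) :
    vhat u S ≤ ∑ x, u x X + (S \ X).card := by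
  refine Finset.sup_le fun A hA => ?_
  obtain ⟨hAS, hdisj⟩ : IsLocalAlloc S A := by simpa using hA
  have hpt : ∀ x, u x (A x) ≤ u x X + (A x \ X).card := fun x =>
    ((hu x).mono (show A x ⊆ X ∪ A x \ X by grind)).trans ((hu x).union_le_add_card _ _)
  have hcard : ∑ x, (A x \ X).card ≤ (S \ X).card := by
    rw [← Finset.card_biUnion fun x _ y _ hxy =>
      (hdisj x y hxy).mono Finset.sdiff_subset Finset.sdiff_subset]
    exact Finset.card_le_card
      (Finset.biUnion_subset.2 fun x _ => Finset.sdiff_subset_sdiff (hAS x) subset_rfl)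
  calc ∑ x, u x (A x) ≤ ∑ x, (u x X + (A x \ X).card) := Finset.sum_le_sum fun x _ => hpt x
    _ ≤ _ := by rw [Finset.sum_add_distrib]; omega

/-- The Rado condition with deficiency, for a target value `k`, yields a local allocation of value
at least `k`: a minimal way of sharing items that satisfies the condition shares no item. -/
theorem exists_isLocalAlloc_of_forall_le (u : L → Finset I → ℕ) (hu : ∀ x, IsMRF (u x))
    (S : Finset I) (k : ℕ) (hk : ∀ X ⊆ S, k ≤ ∑ x, u x X + (S \ X).card) :
    ∃ A : L → Finset I, IsLocalAlloc S A ∧ k ≤ ∑ x, u x (A x) := by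
  let C : Set (I → Finset L) := {F | ∀ X ⊆ S, k ≤ sharedUtility u F X + (S \ X).card}
  obtain ⟨F, hF, hmin⟩ : ∃ F, Minimal (· ∈ C) F :=
    (Set.toFinite C).exists_minimal
      ⟨fun _ => Finset.univ, fun X hX => by simpa [sharedUtility] using hk X hX⟩
  have hviol : ∀ e, ∀ a ∈ F e, ∃ X ⊆ S, e ∈ X ∧
      sharedUtility u (Function.update F e ((F e).erase a)) X + (S \ X).card < k := by
    intro e a ha
    by_contra! h
    have hle : Function.update F e ((F e).erase a) ≤ F :=
      update_le_self_iff.2 (Finset.erase_subset _ _)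
    have hmem : Function.update F e ((F e).erase a) ∈ C := fun X hX => by
      by_cases he : e ∈ X
      · exact h X hX he
      · rw [sharedUtility_update_of_notMem u F he]
        exact hF X hX
    have := hmin hmem hle e ha
    simp at this
  have hone : ∀ e, ∀ a ∈ F e, ∀ b ∈ F e, a = b := by
    intro e a ha b hb
    by_contra hab
    obtain ⟨X, hXS, heX, hX⟩ := hviol e a ha
    obtain ⟨Y, hYS, heY, hY⟩ := hviol e b hb
    have hsub := sharedUtility_union_add_inter_erase_le u hu F hab heX heY
    have hU := hF (X ∪ Y) (by grind)
    have hV := hF ((X ∩ Y).erase e) (by grind)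
    have h₁ := Finset.card_union_add_card_inter X Y
    have h₂ := Finset.card_erase_add_one (Finset.mem_inter.2 ⟨heX, heY⟩)
    have h₃ := Finset.card_sdiff_add_card_eq_card hXS
    have h₄ := Finset.card_sdiff_add_card_eq_card hYS
    have h₅ := Finset.card_sdiff_add_card_eq_card (show X ∪ Y ⊆ S by grind)
    have h₆ := Finset.card_sdiff_add_card_eq_card (show (X ∩ Y).erase e ⊆ S by grind)
    omega
  refine ⟨fun x => S.filter fun i => x ∈ F i, ⟨fun x => Finset.filter_subset _ _, ?_⟩, ?_⟩
  · intro x y hxy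
    refine Finset.disjoint_left.2 fun i hx hy => hxy ?_
    exact hone i x (Finset.mem_filter.1 hx).2 y (Finset.mem_filter.1 hy).2
  · simpa [sharedUtility] using hF S subset_rfl

/-- The hard inequality of the matroid union theorem. -/
theorem exists_sum_add_card_sdiff_le_vhat (u : L → Finset I → ℕ) (hu : ∀ x, IsMRF (u x))
    (S : Finset I) : ∃ X ⊆ S, ∑ x, u x X + (S \ X).card ≤ vhat u S := by
  by_contra! h
  obtain ⟨A, hA, hle⟩ := exists_isLocalAlloc_of_forall_le u hu S (vhat u S + 1) h
  have := hA.sum_le_vhat u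
  omega

end Allocation

/-- the estimated utility `v̂` is submodular: for all `S ⊆ T ⊆ G` and
every `g ∈ G \ T`, `v̂(S ∪ {g}) + v̂(T) ≥ v̂(T ∪ {g}) + v̂(S)`. -/
theorem vhat_submodular {I L : Type*} [Fintype I] [DecidableEq I]
    [Fintype L] [DecidableEq L] [Nonempty L]
    (u : L → Finset I → ℕ) (hu : ∀ x, IsMRF (u x)) :
    ∀ S T : Finset I, S ⊆ T → ∀ g ∉ T,
      vhat u (T ∪ {g}) + vhat u S ≤ vhat u (S ∪ {g}) + vhat u T := by
  intro S T hST g hg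
  obtain ⟨X, hX, hXv⟩ := exists_sum_add_card_sdiff_le_vhat u hu (S ∪ {g})
  obtain ⟨Y, hY, hYv⟩ := exists_sum_add_card_sdiff_le_vhat u hu T
  have hunion := vhat_le u hu (T ∪ {g}) (X ∪ Y)
  have hinter := vhat_le u hu S (X ∩ Y)
  have hsub : ∑ x, u x (X ∪ Y) + ∑ x, u x (X ∩ Y) ≤ ∑ x, u x X + ∑ x, u x Y := by
    rw [← Finset.sum_add_distrib, ← Finset.sum_add_distrib]
    exact Finset.sum_le_sum fun x _ => (hu x).union_add_inter_le X Y
  have hcard : ((T ∪ {g}) \ (X ∪ Y)).card + (S \ (X ∩ Y)).card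
      = ((S ∪ {g}) \ X).card + (T \ Y).card := by
    have hTg : T ∪ {g} = (S ∪ {g}) ∪ T := by grind
    have hS : S = (S ∪ {g}) ∩ T := by grind
    have h₁ := Finset.card_union_add_card_inter (S ∪ {g}) T
    have h₂ := Finset.card_union_add_card_inter X Y
    rw [← hTg, ← hS] at h₁
    have h₃ := Finset.card_sdiff_add_card_eq_card hX
    have h₄ := Finset.card_sdiff_add_card_eq_card hY
    have h₅ := Finset.card_sdiff_add_card_eq_card (show X ∪ Y ⊆ T ∪ {g} by grind)
    have h₆ := Finset.card_sdiff_add_card_eq_card (show X ∩ Y ⊆ S by grind)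
    omega
  omega
end

section
/- The estimated utility v̂ is M♮-concave: for all subsets X, Y ⊆ G and every g ∈ X \ Y, either v̂(X) + v̂(Y) ≤ v̂(X \ {g}) + v̂(Y ∪ {g}), or there exists h ∈ Y \ X such that v̂(X) + v̂(Y) ≤ v̂((X \ {g}) ∪ {h}) + v̂((Y ∪ {g}) \ {h}). -/
open scoped Classical

namespace Matroid

/-- The rank function of a matroid is M♮-concave. -/
theorem eRk_exchange {α : Type*} (M : Matroid α) (X Y : Set α) {g : α} (hgE : g ∈ M.E)
    (hgX : g ∈ X) (hgY : g ∉ Y) :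
    M.eRk X + M.eRk Y ≤ M.eRk (X \ {g}) + M.eRk (insert g Y) ∨
      ∃ h ∈ Y \ X,
        M.eRk X + M.eRk Y ≤ M.eRk (insert h (X \ {g})) + M.eRk (insert g Y \ {h}) := by
  have hX : insert g (X \ {g}) = X := by simp [Set.insert_eq_of_mem hgX]
  have hle : M.eRk X ≤ M.eRk (X \ {g}) + 1 := by
    simpa only [hX] using M.eRk_insert_le_add_one g (X \ {g})
  have hmono : M.eRk Y ≤ M.eRk (insert g Y) := M.eRk_mono (Set.subset_insert g Y)
  by_cases h1 : g ∈ M.closure (X \ {g})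
  · have : M.eRk X = M.eRk (X \ {g}) := by
      rw [← M.eRk_closure_eq X, ← hX, closure_insert_eq_of_mem_closure h1, eRk_closure_eq, hX]
    exact .inl (add_le_add this.le hmono)
  by_cases h2 : g ∈ M.closure Y
  · obtain ⟨C, hCY, hC, hgC⟩ := exists_isCircuit_of_mem_closure h2 hgY
    have hnot : ¬ C \ {g} ⊆ M.closure (X \ {g}) := fun hss ↦
      h1 (M.closure_subset_closure_of_subset_closure hss
        (hC.mem_closure_sdiff_singleton_of_mem hgC))
    obtain ⟨h, ⟨hhC, hhg⟩, hh⟩ := Set.not_subset.1 hnot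
    have hhE : h ∈ M.E := hC.subset_ground hhC
    have hhY : h ∈ Y := (hCY hhC).resolve_left hhg
    refine .inr ⟨h, ⟨hhY, fun hhX ↦ hh (M.mem_closure_of_mem' ⟨hhX, hhg⟩ hhE)⟩, ?_⟩
    have hcl : M.closure (insert g Y \ {h}) = M.closure (insert g Y) :=
      closure_sdiff_singleton_eq_closure
        (M.closure_subset_closure (Set.sdiff_subset_sdiff_left hCY)
          (hC.mem_closure_sdiff_singleton_of_mem hhC))
    rw [eRk_insert_eq_add_one ⟨hhE, hh⟩, ← M.eRk_closure_eq (insert g Y \ {h}), hcl,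
      eRk_closure_eq]
    exact add_le_add hle hmono
  · rw [eRk_insert_eq_add_one ⟨hgE, h2⟩, add_comm (M.eRk Y), ← add_assoc]
    exact .inl (add_le_add hle le_rfl)

end Matroid

namespace IsMRF

variable {I : Type*} [DecidableEq I] {u : Finset I → ℕ}

theorem insert_le (hu : IsMRF u) (S : Finset I) (g : I) : u (insert g S) ≤ u S + 1 := by
  by_cases hg : g ∈ S
  · simp [Finset.insert_eq_of_mem hg]
  · have := (hu.2.2.2 S g hg).2
    rwa [Finset.union_singleton] at this

theorem union_le (hu : IsMRF u) (S T : Finset I) : u (S ∪ T) ≤ u S + T.card := by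
  induction T using Finset.induction_on with
  | empty => simp
  | insert a T ha ih =>
    rw [Finset.union_insert, Finset.card_insert_of_notMem ha]
    have := hu.insert_le (S ∪ T) a
    omega

theorem le_card (hu : IsMRF u) (S : Finset I) : u S ≤ S.card := by
  simpa [hu.1] using hu.union_le ∅ S

theorem eq_card_of_subset (hu : IsMRF u) {S T : Finset I} (hT : u T = T.card) (hST : S ⊆ T) :
    u S = S.card := by
  have h := hu.union_le S (T \ S)
  rw [Finset.union_sdiff_of_subset hST, hT] at h
  have := Finset.card_sdiff_add_card_eq_card hST
  have := hu.le_card S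
  omega

theorem exists_lt_insert (hu : IsMRF u) {S T : Finset I} (h : u S < u T) :
    ∃ e ∈ T, u S < u (insert e S) := by
  by_contra! hcon
  have key : ∀ R ⊆ T, u (S ∪ R) ≤ u S := by
    intro R
    induction R using Finset.induction_on with
    | empty => simp
    | insert a R ha ih =>
      intro hR
      have ih := ih ((Finset.subset_insert a R).trans hR)
      have hca := hcon a (hR (Finset.mem_insert_self a R))
      rw [Finset.union_insert]
      by_cases haS : a ∈ S ∪ R
      · rwa [Finset.insert_eq_of_mem haS]
      · have := hu.2.2.1 S (S ∪ R) Finset.subset_union_left a haS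
        simp only [Finset.union_singleton] at this
        omega
  have := key T subset_rfl
  have := hu.2.1 T (S ∪ T) Finset.subset_union_right
  omega

theorem exists_subset_eq_card (hu : IsMRF u) (S : Finset I) :
    ∃ T ⊆ S, u T = T.card ∧ T.card = u S := by
  induction S using Finset.induction_on with
  | empty => exact ⟨∅, by simp [hu.1]⟩
  | insert a S ha ih =>
    obtain ⟨T, hTS, hT, hTc⟩ := ih
    by_cases hlt : u T < u (insert a S)
    · obtain ⟨e, he, hlt'⟩ := hu.exists_lt_insert hlt
      have heT : e ∉ T := fun h ↦ by simp [Finset.insert_eq_of_mem h] at hlt'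
      have := hu.insert_le T e
      have := hu.insert_le S a
      refine ⟨insert e T,
        Finset.insert_subset he (hTS.trans (Finset.subset_insert a S)), ?_, ?_⟩ <;>
      · rw [Finset.card_insert_of_notMem heT]
        omega
    · have := hu.2.1 T (insert a S) (hTS.trans (Finset.subset_insert a S))
      exact ⟨T, hTS.trans (Finset.subset_insert a S), hT, by omega⟩

end IsMRF

section Union

variable {I L : Type*} [DecidableEq I] [Fintype L] {u : L → Finset I → ℕ}

/-- `A` partitions `S` into sets that are independent for the respective valuations. -/
def IsIndepPartition (u : L → Finset I → ℕ) (S : Finset I) (A : L → Finset I) : Prop :=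
  Pairwise (fun x y ↦ Disjoint (A x) (A y)) ∧ (∀ x, u x (A x) = (A x).card) ∧
    Finset.univ.biUnion A = S

theorem IsIndepPartition.card_eq {S : Finset I} {A : L → Finset I}
    (hA : IsIndepPartition u S A) : S.card = ∑ x, (A x).card := by
  rw [← hA.2.2, Finset.card_biUnion fun x _ y _ hxy ↦ hA.1 hxy]

/-- Moving `e` to the part of an agent `x` for which it is still independent. -/
theorem IsIndepPartition.insert [DecidableEq L] (hu : ∀ x, IsMRF (u x)) {S : Finset I}
    {A : L → Finset I} (hA : IsIndepPartition u S A) {x : L} {e : I}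
    (he : u x (A x) < u x (insert e (A x))) :
    IsIndepPartition u (insert e S)
      (fun z ↦ if z = x then insert e (A z) else (A z).erase e) := by
  obtain ⟨hdisj, hind, rfl⟩ := hA
  have heA : e ∉ A x := fun h ↦ by simp [Finset.insert_eq_of_mem h] at he
  refine ⟨fun y z hyz ↦ ?_, fun z ↦ ?_, ?_⟩
  · have h := Finset.disjoint_left.1 (hdisj hyz)
    dsimp only
    rw [Finset.disjoint_left]
    intro a
    split_ifs <;> simp only [Finset.mem_insert, Finset.mem_erase] <;> grind
  · dsimp only
    split_ifs with hz
    · subst hz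
      have := (hu z).insert_le (A z) e
      have := hind z
      rw [Finset.card_insert_of_notMem heA]
      omega
    · exact (hu z).eq_card_of_subset (hind z) (Finset.erase_subset _ _)
  · ext a
    simp only [Finset.mem_biUnion, Finset.mem_univ, true_and, Finset.mem_insert]
    constructor
    · rintro ⟨z, hz⟩
      split_ifs at hz <;> grind
    · rintro (rfl | ⟨z, hz⟩)
      · exact ⟨x, by simp⟩
      · by_cases hae : a = e
        · exact ⟨x, by simp [hae]⟩
        · exact ⟨z, by split_ifs <;> simp [hae, hz]⟩

theorem IsIndepPartition.exists_insert [Fintype I] (hu : ∀ x, IsMRF (u x)) {S T : Finset I}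
    {A₀ B : L → Finset I} (hA₀ : IsIndepPartition u S A₀) (hB : IsIndepPartition u T B)
    (hST : S.card < T.card) :
    ∃ e ∈ T, e ∉ S ∧ ∃ A, IsIndepPartition u (Insert.insert e S) A := by
  obtain ⟨A, hA, hmax⟩ := (Finset.univ.filter (IsIndepPartition u S)).exists_max_image
    (fun A ↦ ∑ x, (A x ∩ B x).card) ⟨A₀, by simpa using hA₀⟩
  simp only [Finset.mem_filter, Finset.mem_univ, true_and] at hA hmax
  rw [hA.card_eq, hB.card_eq] at hST
  obtain ⟨x, -, hx⟩ := Finset.exists_lt_of_sum_lt hST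
  rw [← hA.2.1 x, ← hB.2.1 x] at hx
  obtain ⟨e, heB, he⟩ := (hu x).exists_lt_insert hx
  have heA : e ∉ A x := fun h ↦ by simp [Finset.insert_eq_of_mem h] at he
  have hA' := hA.insert hu he
  refine ⟨e, ?_, fun heS ↦ ?_, _, hA'⟩
  · rw [← hB.2.2]
    exact Finset.mem_biUnion.2 ⟨x, Finset.mem_univ x, heB⟩
  · rw [Finset.insert_eq_of_mem heS] at hA'
    refine (hmax _ hA').not_gt (Finset.sum_lt_sum (fun z _ ↦ Finset.card_le_card ?_)
      ⟨x, Finset.mem_univ x, Finset.card_lt_card ?_⟩)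
    · intro a ha
      rw [Finset.mem_inter] at ha ⊢
      refine ⟨?_, ha.2⟩
      split_ifs with hz
      · exact Finset.mem_insert_of_mem ha.1
      · refine Finset.mem_erase.2 ⟨?_, ha.1⟩
        rintro rfl
        exact Finset.disjoint_left.1 (hB.1 hz) ha.2 heB
    · rw [if_pos rfl, Finset.insert_inter_of_mem heB]
      exact Finset.ssubset_insert fun h ↦ heA (Finset.mem_inter.1 h).1

/-- The union of the matroids whose rank functions are the valuations `u x`. -/
noncomputable def unionMatroid [Fintype I] (u : L → Finset I → ℕ) (hu : ∀ x, IsMRF (u x)) :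
    Matroid I :=
  (IndepMatroid.ofFinset Set.univ (fun S ↦ ∃ A, IsIndepPartition u S A)
    ⟨fun _ ↦ ∅, fun _ _ _ ↦ Finset.disjoint_empty_left _, fun x ↦ by simp [(hu x).1],
      by ext; simp⟩
    (by
      rintro S T ⟨A, hdisj, hind, rfl⟩ hST
      refine ⟨fun x ↦ A x ∩ S, fun x y hxy ↦ ?_, fun x ↦ ?_, ?_⟩
      · exact (hdisj hxy).mono Finset.inter_subset_left Finset.inter_subset_left
      · exact (hu x).eq_card_of_subset (hind x) Finset.inter_subset_left
      · rw [← Finset.biUnion_inter, Finset.inter_eq_right.2 hST])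
    (by
      rintro S T ⟨A, hA⟩ ⟨B, hB⟩ hST
      exact hA.exists_insert hu hB hST)
    (fun _ _ ↦ Set.subset_univ _)).matroid

theorem unionMatroid_indep_iff [Fintype I] (hu : ∀ x, IsMRF (u x)) (S : Finset I) :
    (unionMatroid u hu).Indep S ↔ ∃ A, IsIndepPartition u S A := by
  simp [unionMatroid]

theorem unionMatroid_eRk [Fintype I] [DecidableEq L] (hu : ∀ x, IsMRF (u x)) (S : Finset I) :
    (unionMatroid u hu).eRk S = vhat u S := by
  apply le_antisymm
  · rw [Matroid.eRk_le_iff]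
    intro T hTS hT
    obtain ⟨T, rfl⟩ := T.toFinite.exists_finset_coe
    obtain ⟨A, hA⟩ := (unionMatroid_indep_iff hu T).1 hT
    rw [Set.encard_coe_eq_coe_finsetCard, hA.card_eq, Nat.cast_le,
      Finset.sum_congr rfl fun x _ ↦ (hA.2.1 x).symm]
    refine Finset.le_sup (f := fun A : L → Finset I ↦ ∑ x, u x (A x))
      (Finset.mem_filter.2 ⟨Finset.mem_univ A, fun x ↦ ?_, fun x y hxy ↦ hA.1 hxy⟩)
    refine Finset.Subset.trans ?_ (Finset.coe_subset.1 hTS)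
    rw [← hA.2.2]
    exact Finset.subset_biUnion_of_mem A (Finset.mem_univ x)
  · have hne : (Finset.univ.filter fun A : L → Finset I ↦ IsLocalAlloc S A).Nonempty :=
      ⟨fun _ ↦ ∅, Finset.mem_filter.2 ⟨Finset.mem_univ _, by simp [IsLocalAlloc]⟩⟩
    obtain ⟨A, hA, hAeq⟩ := Finset.exists_mem_eq_sup _ hne fun A ↦ ∑ x, u x (A x)
    obtain ⟨hAS, hdisj⟩ := (Finset.mem_filter.1 hA).2
    choose B hBA hB hBc using fun x ↦ (hu x).exists_subset_eq_card (A x)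
    have hpart : IsIndepPartition u (Finset.univ.biUnion B) B :=
      ⟨fun x y hxy ↦ (hdisj x y hxy).mono (hBA x) (hBA y), hB, rfl⟩
    refine Matroid.le_eRk_iff.2 ⟨(Finset.univ.biUnion B : Finset I), ?_,
      (unionMatroid_indep_iff hu _).2 ⟨B, hpart⟩, ?_⟩
    · exact Finset.coe_subset.2 (Finset.biUnion_subset.2 fun x _ ↦ (hBA x).trans (hAS x))
    · rw [Set.encard_coe_eq_coe_finsetCard, hpart.card_eq, vhat, hAeq,
        Finset.sum_congr rfl fun x _ ↦ hBc x]

end Union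

/-- the estimated utility `v̂` is M♮-concave: for all `X, Y ⊆ G` and every
`g ∈ X \ Y`, either `v̂(X) + v̂(Y) ≤ v̂(X \ {g}) + v̂(Y ∪ {g})`, or there exists
`h ∈ Y \ X` with `v̂(X) + v̂(Y) ≤ v̂((X \ {g}) ∪ {h}) + v̂((Y ∪ {g}) \ {h})`. -/
theorem vhat_MNatConcave {I L : Type*} [Fintype I] [DecidableEq I]
    [Fintype L] [DecidableEq L] [Nonempty L]
    (u : L → Finset I → ℕ) (hu : ∀ x, IsMRF (u x)) :
    ∀ X Y : Finset I, ∀ g ∈ X \ Y,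
      vhat u X + vhat u Y ≤ vhat u (X \ {g}) + vhat u (Y ∪ {g}) ∨
      ∃ h ∈ Y \ X,
        vhat u X + vhat u Y ≤ vhat u ((X \ {g}) ∪ {h}) + vhat u ((Y ∪ {g}) \ {h}) := by
  intro X Y g hg
  obtain ⟨hgX, hgY⟩ := Finset.mem_sdiff.1 hg
  have key := (unionMatroid u hu).eRk_exchange (X : Set I) (Y : Set I) (g := g)
    (Set.mem_univ g) (by simpa using hgX) (by simpa using hgY)
  simp only [← Finset.coe_singleton, ← Finset.coe_sdiff, ← Finset.coe_insert,
    unionMatroid_eRk hu, Finset.mem_coe] at key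
  simpa only [Finset.union_singleton, ← Nat.cast_add, Nat.cast_le] using key
end
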